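/- Let Γ ↷ X be an action of a countably infinite amenable group on the Cantor set, and let G be an infinite subgroup of [[Γ ↷ X]] containing 𝔄(Γ,X). Then G is inner amenable. -/

import Mathlib

/-- A mean on a set `Z`: a finitely additive probability measure defined on all subsets. -/
def IsMean {Z : Type*} (m : Set Z → ℝ) : Prop :=
  m Set.univ = 1 ∧ (∀ A : Set Z, 0 ≤ m A) ∧
    ∀ A B : Set Z, Disjoint A B → m (A ∪ B) = m A + m B

/-- Amenability of a group: existence of a left-translation-invariant mean. -/
def HasLeftInvariantMean (Γ : Type*) [Group Γ] : Prop :=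
  ∃ m : Set Γ → ℝ, IsMean m ∧ ∀ (g : Γ) (A : Set Γ), m ((fun h => g * h) '' A) = m A

/-- A group is inner amenable if there is an atomless conjugation-invariant mean on it. -/
def InnerAmenable (G : Type*) [Group G] : Prop :=
  ∃ m : Set G → ℝ, IsMean m ∧ (∀ A : Set G, A.Finite → m A = 0) ∧
    ∀ (g : G) (A : Set G), m ((fun h => g * h * g⁻¹) '' A) = m A

/-- A permutation `T` of `X` is a piecewise translation for the action of `Γ` if there are a
finite clopen partition `A₁, …, Aₙ` of `X` and `s₁, …, sₙ ∈ Γ` with `T x = sᵢ • x` on `Aᵢ`.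
The topological full group `[[Γ ↷ X]]` is the set of such permutations. -/
def IsPiecewiseTranslation (Γ : Type*) {X : Type*} [Group Γ] [TopologicalSpace X]
    [MulAction Γ X] (T : Equiv.Perm X) : Prop :=
  ∃ (n : ℕ) (A : Fin n → Set X) (s : Fin n → Γ),
    (∀ i, IsClopen (A i)) ∧ Pairwise (Function.onFun Disjoint A) ∧
    (⋃ i, A i) = Set.univ ∧ ∀ i, ∀ x ∈ A i, T x = s i • x

/-- The dynamical alternating group `𝔄(Γ, X)`. -/
def dynAlternating (Γ X : Type*) [Group Γ] [TopologicalSpace X] [MulAction Γ X] :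
    Subgroup (Equiv.Perm X) :=
  Subgroup.closure
    {g | ∃ (φ : Equiv.Perm (Fin 3) →* Equiv.Perm X) (A : Fin 3 → Set X),
      (∀ σ, IsPiecewiseTranslation Γ (φ σ)) ∧ (∀ i, IsClopen (A i)) ∧
      Pairwise (Function.onFun Disjoint A) ∧
      (∀ (σ : Equiv.Perm (Fin 3)), ∀ x ∉ ⋃ i, A i, φ σ x = x) ∧
      (∀ (σ : Equiv.Perm (Fin 3)) (i : Fin 3), φ σ '' A i = A (σ i)) ∧
      ∃ σ : Equiv.Perm (Fin 3), Equiv.Perm.sign σ = 1 ∧ g = φ σ}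

open Filter Topology

theorem innerAmenable_of_finite_closure {G : Type*} [Group G] [Infinite G]
    (h : ∀ F : Finset G, Finite (Subgroup.closure (F : Set G))) : InnerAmenable G := by
  let K : Finset G → Set G := fun F => Subgroup.closure (F : Set G)
  have hK : ∀ F, (K F).Finite := fun F => Set.toFinite _
  have hpos : ∀ F, 0 < ((K F).ncard : ℝ) := fun F => by
    exact_mod_cast (Set.ncard_pos (hK F)).2 ⟨1, one_mem (Subgroup.closure (F : Set G))⟩
  let d : Set G → Finset G → ℝ := fun B F => (K F ∩ B).ncard / (K F).ncard
  have hd : ∀ B F, d B F ∈ Set.Icc (0 : ℝ) 1 := fun B F =>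
    ⟨by positivity, (div_le_one (hpos F)).2 (by
      exact_mod_cast Set.ncard_le_ncard Set.inter_subset_left (hK F))⟩
  let 𝒰 : Ultrafilter (Finset G) := Ultrafilter.of atTop
  have h𝒰 : (𝒰 : Filter (Finset G)) ≤ atTop := Ultrafilter.of_le _
  have hlim : ∀ B, ∃ l ∈ Set.Icc (0 : ℝ) 1, Tendsto (d B) 𝒰 (𝓝 l) := fun B =>
    isCompact_Icc.ultrafilter_le_nhds (𝒰.map (d B))
      (le_principal_iff.2 (Filter.mem_map.2 (univ_mem' (hd B))))
  choose m hm01 hm using hlim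
  refine ⟨m, ⟨?_, fun B => (hm01 B).1, fun A B hAB => ?_⟩, fun A hA => ?_, fun g B => ?_⟩
  · refine tendsto_nhds_unique (hm _) (tendsto_const_nhds.congr fun F => ?_)
    simp [d, (hpos F).ne']
  · refine tendsto_nhds_unique (hm _) (((hm A).add (hm B)).congr fun F => ?_)
    simp only [d]
    rw [Set.inter_union_distrib_left, Set.ncard_union_eq
      (hAB.mono Set.inter_subset_right Set.inter_subset_right)
      ((hK F).inter_of_left _) ((hK F).inter_of_left _), Nat.cast_add, add_div]
  · have hcard : Tendsto (fun F => ((K F).ncard : ℝ)) atTop atTop := by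
      refine tendsto_natCast_atTop_atTop.comp (tendsto_atTop.2 fun k => ?_)
      obtain ⟨F₀, hF₀⟩ := Infinite.exists_subset_card_eq G k
      filter_upwards [eventually_ge_atTop F₀] with F hF
      rw [← hF₀, ← Set.ncard_coe_finset]
      exact Set.ncard_le_ncard ((Finset.coe_subset.2 hF).trans Subgroup.subset_closure) (hK F)
    refine tendsto_nhds_unique (hm A) (squeeze_zero (fun F => (hd A F).1) (fun F => ?_)
      ((tendsto_const_nhds (x := (A.ncard : ℝ))).div_atTop (hcard.mono_left h𝒰)))
    simp only [d]
    gcongr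
    exact Set.inter_subset_right
  · refine tendsto_nhds_unique (hm _) ((hm B).congr' ?_)
    filter_upwards [h𝒰 (eventually_ge_atTop {g})] with F hF
    have hg : g ∈ Subgroup.closure (F : Set G) :=
      Subgroup.subset_closure (Finset.singleton_subset_iff.1 hF)
    have himg : K F ∩ (fun h => g * h * g⁻¹) '' B = (fun h => g * h * g⁻¹) '' (K F ∩ B) := by
      ext z
      constructor
      · rintro ⟨hz, h, hB, rfl⟩
        refine ⟨h, ⟨?_, hB⟩, rfl⟩
        exact ((Subgroup.mul_mem_cancel_left _ hg).1
          ((Subgroup.mul_mem_cancel_right _ (inv_mem hg)).1 hz))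
      · rintro ⟨h, ⟨hz, hB⟩, rfl⟩
        exact ⟨mul_mem (mul_mem hg hz) (inv_mem hg), h, hB, rfl⟩
    simp only [d]
    rw [himg, Set.ncard_image_of_injective (f := fun h => g * h * g⁻¹) _ (MulAut.conj g).injective]

theorem Group.finite_of_fg_of_orbit_encard_le {H X : Type*} [Group H] [Group.FG H]
    [MulAction H X] [FaithfulSMul H X] (N : ℕ)
    (hN : ∀ x : X, (MulAction.orbit H x).encard ≤ N) : Finite H := by
  obtain ⟨S, hS⟩ := Group.fg_def.1 ‹Group.FG H›
  have hfin : Finite (H →* Equiv.Perm (Fin N)) :=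
    Finite.of_injective (fun ψ (s : S) => ψ s) fun ψ₁ ψ₂ h =>
      MonoidHom.eq_of_eqOn_dense hS fun s hs => congrFun h ⟨s, hs⟩
  refine Finite.of_injective (fun (h : H) (ψ : H →* Equiv.Perm (Fin N)) => ψ h)
    fun a b hab => FaithfulSMul.eq_of_smul_eq_smul (α := X) fun x => ?_
  have hxfin : (MulAction.orbit H x).Finite :=
    Set.finite_of_encard_le_coe (hN x)
  have := hxfin.to_subtype
  have := Fintype.ofFinite (MulAction.orbit H x)
  obtain ⟨e⟩ : Nonempty (MulAction.orbit H x ↪ Fin N) := by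
    refine Function.Embedding.nonempty_of_card_le ?_
    have := hN x
    rw [← hxfin.cast_ncard_eq] at this
    rw [Fintype.card_fin, ← Nat.card_eq_fintype_card]
    exact_mod_cast this
  have h := congrFun hab ((Equiv.Perm.viaEmbeddingHom e).comp
    (MulAction.toPermHom H (MulAction.orbit H x)))
  have h' := Equiv.Perm.viaEmbeddingHom_injective e h
  exact congrArg Subtype.val (DFunLike.congr_fun h' ⟨x, MulAction.mem_orbit_self x⟩)

theorem encard_inter_biUnion_le {X : Type*} (t : Finset (Set X)) (S : Set X)
    (h : ∀ U ∈ t, (S ∩ U).encard ≤ 2) : (S ∩ ⋃ U ∈ t, U).encard ≤ (2 * t.card : ℕ) := by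
  classical
  induction t using Finset.induction_on with
  | empty => simp
  | insert U t hU ih =>
    rw [Finset.set_biUnion_insert, Set.inter_union_distrib_left, Finset.card_insert_of_notMem hU]
    refine (Set.encard_union_le _ _).trans ((add_le_add (h U (Finset.mem_insert_self U t))
      (ih fun V hV => h V (Finset.mem_insert_of_mem hV))).trans (le_of_eq ?_))
    push_cast
    ring

theorem innerAmenable_of_orbit_encard_le {X : Type*} (G : Subgroup (Equiv.Perm X)) [Infinite G]
    (N : ℕ) (hN : ∀ x : X, (MulAction.orbit G x).encard ≤ N) : InnerAmenable G := by
  refine innerAmenable_of_finite_closure fun F => ?_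
  refine Group.finite_of_fg_of_orbit_encard_le (X := X) N fun x =>
    (Set.encard_le_encard ?_).trans (hN x)
  rintro _ ⟨g, rfl⟩
  exact ⟨g.1, rfl⟩

theorem Equiv.Perm.conj_eq_conj_of_eqOn {X : Type*} {a b h : Equiv.Perm X} {V : Set X}
    (hab : Set.EqOn a b V) (hV : ∀ z ∉ V, h z = z) : a * h * a⁻¹ = b * h * b⁻¹ := by
  have hc : Commute (b⁻¹ * a) h := by
    refine Equiv.Perm.Disjoint.commute fun z => ?_
    by_cases hz : z ∈ V
    · left
      rw [Equiv.Perm.mul_apply, hab hz, Equiv.Perm.inv_def, Equiv.symm_apply_apply]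
    · exact .inr (hV z hz)
  have := hc.eq
  calc a * h * a⁻¹ = b * (b⁻¹ * a * h) * a⁻¹ := by group
    _ = b * h * b⁻¹ := by rw [this]; group

namespace IsMean

variable {Z : Type*} {m : Set Z → ℝ}

theorem apply_empty (hm : IsMean m) : m ∅ = 0 := by
  have := hm.2.2 ∅ ∅ (Set.disjoint_empty _)
  rw [Set.union_empty] at this
  linarith

theorem apply_biUnion (hm : IsMean m) {ι : Type*} (t : Finset ι) (P : ι → Set Z)
    (hP : Pairwise (Function.onFun Disjoint P)) : m (⋃ i ∈ t, P i) = ∑ i ∈ t, m (P i) := by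
  classical
  induction t using Finset.induction_on with
  | empty => simp [hm.apply_empty]
  | insert i t hi ih =>
    rw [Finset.set_biUnion_insert, Finset.sum_insert hi, hm.2.2, ih]
    refine Set.disjoint_iUnion₂_right.2 fun j hj => hP ?_
    rintro rfl
    exact hi hj

theorem apply_eq_sum_inter (hm : IsMean m) {ι : Type*} [Fintype ι] {P : ι → Set Z}
    (hP : Pairwise (Function.onFun Disjoint P)) (hP' : ⋃ i, P i = Set.univ) (E : Set Z) :
    m E = ∑ i, m (E ∩ P i) := by
  rw [← hm.apply_biUnion _ _ fun i j hij =>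
    (hP hij).mono Set.inter_subset_right Set.inter_subset_right]
  simp [← Set.inter_iUnion, hP']

end IsMean

/-- `Equiv.Perm ι` acting on `X` by permuting the copies `e (i, V)` of `V`, fixing the rest. -/
noncomputable def permHom {X : Type*} {ι : Type*} {V : Set X} (e : ι × V ↪ X) :
    Equiv.Perm ι →* Equiv.Perm X :=
  (Equiv.Perm.viaEmbeddingHom e).comp
    { toFun := fun σ => σ.prodCongr (Equiv.refl V)
      map_one' := rfl
      map_mul' := fun _ _ => rfl }

theorem permHom_apply {X : Type*} {ι : Type*} {V : Set X} (e : ι × V ↪ X) (σ : Equiv.Perm ι)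
    (i : ι) (v : V) : permHom e σ (e (i, v)) = e (σ i, v) :=
  Equiv.Perm.viaEmbedding_apply _ _ _

theorem permHom_apply_of_notMem {X : Type*} {ι : Type*} {V : Set X} (e : ι × V ↪ X)
    (σ : Equiv.Perm ι) {x : X} (hx : x ∉ Set.range e) : permHom e σ x = x :=
  Equiv.Perm.viaEmbedding_apply_of_notMem _ _ _ hx

theorem conj_permHom {X : Type*} {ι : Type*} {V : Set X} (e : ι × V ↪ X) (σ : Equiv.Perm ι)
    (a : Equiv.Perm X) :
    a * permHom e σ * a⁻¹ = permHom (e.trans a.toEmbedding) σ := by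
  ext x
  obtain ⟨x, rfl⟩ := a.surjective x
  simp only [Equiv.Perm.mul_apply, Equiv.Perm.inv_def, Equiv.symm_apply_apply]
  by_cases hx : x ∈ Set.range e
  · obtain ⟨⟨i, v⟩, rfl⟩ := hx
    rw [permHom_apply]
    exact (permHom_apply (e.trans a.toEmbedding) σ i v).symm
  · rw [permHom_apply_of_notMem _ _ hx, permHom_apply_of_notMem]
    rintro ⟨p, hp⟩
    exact hx ⟨p, a.injective hp⟩

section

variable {Γ X : Type*} [Group Γ] [TopologicalSpace X] [MulAction Γ X]

theorem IsClopen.smul_set (hcont : ∀ g : Γ, Continuous fun x : X => g • x) {V : Set X}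
    (hV : IsClopen V) (g : Γ) : IsClopen ((fun x => g • x) '' V) := by
  have : (fun x : X => g • x) '' V = (fun x => g⁻¹ • x) ⁻¹' V := by
    ext x
    simp [Set.mem_image, smul_eq_iff_eq_inv_smul]
  rw [this]
  exact hV.preimage (hcont _)

theorem permHom_mem_dynAlternating (hcont : ∀ g : Γ, Continuous fun x : X => g • x)
    {V : Set X} (hV : IsClopen V) (g : Fin 3 → Γ) (e : Fin 3 × V ↪ X)
    (he : ∀ i v, e (i, v) = g i • (v : X)) {σ : Equiv.Perm (Fin 3)}
    (hσ : Equiv.Perm.sign σ = 1) : permHom e σ ∈ dynAlternating Γ X := by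
  let A : Fin 3 → Set X := fun i => (fun x => g i • x) '' V
  have hA : ∀ i, IsClopen (A i) := fun i => hV.smul_set hcont (g i)
  have hdis : Pairwise (Function.onFun Disjoint A) := by
    intro i j hij
    refine Set.disjoint_left.2 ?_
    rintro _ ⟨v, hv, rfl⟩ ⟨w, hw, h⟩
    have : e (j, ⟨w, hw⟩) = e (i, ⟨v, hv⟩) := by simpa only [he] using h
    exact hij (congrArg Prod.fst (e.injective this)).symm
  have hfix : ∀ (σ : Equiv.Perm (Fin 3)), ∀ x ∉ ⋃ i, A i, permHom e σ x = x := by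
    intro σ x hx
    refine permHom_apply_of_notMem e σ ?_
    rintro ⟨⟨i, v⟩, rfl⟩
    exact hx (Set.mem_iUnion.2 ⟨i, v, v.2, (he i v).symm⟩)
  have hmov : ∀ (σ : Equiv.Perm (Fin 3)) (i : Fin 3), ∀ v ∈ V,
      permHom e σ (g i • v) = g (σ i) • v := by
    intro σ i v hv
    have := permHom_apply e σ i ⟨v, hv⟩
    simpa only [he] using this
  refine Subgroup.subset_closure ⟨permHom e, A, fun σ => ?_, hA, hdis, hfix, fun σ i => ?_,
    σ, hσ, rfl⟩
  · refine ⟨4, Fin.cons (⋃ i, A i)ᶜ A, Fin.cons 1 fun i => g (σ i) * (g i)⁻¹, ?_, ?_, ?_, ?_⟩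
    · intro i
      refine Fin.cases ?_ (fun i => ?_) i
      · exact (isClopen_iUnion_of_finite hA).compl
      · exact hA i
    · intro i j
      refine Fin.cases ?_ (fun i => ?_) i <;> refine Fin.cases ?_ (fun j => ?_) j
      · exact fun h => absurd rfl h
      · exact fun _ => (Set.disjoint_compl_left_iff_subset.2 (Set.subset_iUnion A j))
      · exact fun _ => (Set.disjoint_compl_right_iff_subset.2 (Set.subset_iUnion A i))
      · exact fun h => hdis fun hij => h (congrArg Fin.succ hij)
    · refine Set.eq_univ_of_forall fun x => ?_
      by_cases hx : x ∈ ⋃ i, A i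
      · obtain ⟨i, hi⟩ := Set.mem_iUnion.1 hx
        exact Set.mem_iUnion.2 ⟨i.succ, hi⟩
      · exact Set.mem_iUnion.2 ⟨0, hx⟩
    · intro i
      refine Fin.cases ?_ (fun i => ?_) i
      · intro x hx
        simpa using hfix σ x hx
      · rintro _ ⟨v, hv, rfl⟩
        simpa [mul_smul] using hmov σ i v hv
  · ext x
    constructor
    · rintro ⟨_, ⟨v, hv, rfl⟩, rfl⟩
      exact ⟨v, hv, (hmov σ i v hv).symm⟩
    · rintro ⟨v, hv, rfl⟩
      exact ⟨_, ⟨v, hv, rfl⟩, hmov σ i v hv⟩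

theorem exists_conj_mem_dynAlternating [T2Space X] [CompactSpace X] [TotallyDisconnectedSpace X]
    (hcont : ∀ g : Γ, Continuous fun x : X => g • x) {U : Set X} (hU : IsOpen U) {y : X}
    {g : Fin 3 → Γ} (hg : Function.Injective fun i => g i • y) (hgU : ∀ i, g i • y ∈ U) :
    ∃ h : Equiv.Perm X, h ≠ 1 ∧ (∀ z ∉ U, h z = z) ∧
      ∀ s : Γ, MulAction.toPerm s * h * (MulAction.toPerm s)⁻¹ ∈ dynAlternating Γ X := by
  obtain ⟨O, hO, hOdis⟩ := (Set.toFinite (Set.range fun i => g i • y)).t2_separation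
  let W : Set X := ⋂ i, (fun x => g i • x) ⁻¹' (O (g i • y) ∩ U)
  have hW : IsOpen W := isOpen_iInter_of_finite fun i =>
    ((hO _).2.inter hU).preimage (hcont (g i))
  obtain ⟨V, hV, hyV, hVW⟩ := compact_exists_isClopen_in_isOpen hW
    (Set.mem_iInter.2 fun i => ⟨(hO _).1, hgU i⟩ : y ∈ W)
  have hVO : ∀ i, ∀ v ∈ V, g i • v ∈ O (g i • y) ∩ U := fun i v hv => Set.mem_iInter.1 (hVW hv) i
  let e : Fin 3 × V ↪ X := ⟨fun p => g p.1 • (p.2 : X), by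
    rintro ⟨i, v⟩ ⟨j, w⟩ h
    have hij : i = j := by
      by_contra hij
      refine Set.disjoint_left.1 (hOdis ⟨i, rfl⟩ ⟨j, rfl⟩ fun h => hij (hg h))
        (hVO i v v.2).1 ?_
      simpa only [h] using (hVO j w w.2).1
    subst hij
    exact Prod.ext rfl (Subtype.ext (MulAction.injective (g i) h))⟩
  refine ⟨permHom e (finRotate 3), fun h => ?_, fun z hz => ?_, fun s => ?_⟩
  · have h0 := permHom_apply e (finRotate 3) 0 ⟨y, hyV⟩
    rw [h, Equiv.Perm.one_apply] at h0
    have h1 : (0 : Fin 3) = finRotate 3 0 := congrArg Prod.fst (e.injective h0)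
    exact absurd h1 (by decide)
  · refine permHom_apply_of_notMem e _ ?_
    rintro ⟨⟨i, v⟩, rfl⟩
    exact hz (hVO i v v.2).2
  · rw [conj_permHom]
    exact permHom_mem_dynAlternating hcont hV (fun i => s * g i) _
      (fun i v => (mul_smul s (g i) (v : X)).symm) (by simp [sign_finRotate])

end

section

variable {Γ X : Type*} [Group Γ] [TopologicalSpace X] [MulAction Γ X]

theorem innerAmenable_of_ultrafilter (hcont : ∀ g : Γ, Continuous fun x : X => g • x)
    (hamen : HasLeftInvariantMean Γ) (G : Subgroup (Equiv.Perm X))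
    (hG : (G : Set (Equiv.Perm X)) ⊆ {T | IsPiecewiseTranslation Γ T}) (x : X) [T1Space X]
    (𝒰 : Ultrafilter (Equiv.Perm X)) (hne : ∀ᶠ h in (𝒰 : Filter (Equiv.Perm X)), h ≠ 1)
    (hsupp : ∀ V ∈ 𝓝 x, ∀ᶠ h in (𝒰 : Filter (Equiv.Perm X)), ∀ z ∉ V, h z = z)
    (hconj : ∀ᶠ h in (𝒰 : Filter (Equiv.Perm X)), ∀ s : Γ,
      MulAction.toPerm s * h * (MulAction.toPerm s)⁻¹ ∈ G) : InnerAmenable G := by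
  obtain ⟨m, hm, hinv⟩ := hamen
  let c : Γ → Equiv.Perm X → Equiv.Perm X := fun s h =>
    MulAction.toPerm s * h * (MulAction.toPerm s)⁻¹
  let E : Set G → Set Γ := fun B =>
    {s | ∀ᶠ h in (𝒰 : Filter (Equiv.Perm X)), c s h ∈ Subtype.val '' B}
  refine ⟨fun B => m (E B), ⟨?_, fun B => hm.2.1 _, fun A B hAB => ?_⟩, fun A hA => ?_,
    fun T B => ?_⟩
  · have : E Set.univ = Set.univ := Set.eq_univ_of_forall fun s => by
      filter_upwards [hconj] with h hh
      exact ⟨⟨_, hh s⟩, trivial, rfl⟩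
    simp only [this, hm.1]
  · have hunion : E (A ∪ B) = E A ∪ E B := by
      ext s
      simp only [E, Set.image_union, Set.mem_ofPred_eq, Set.mem_union, Ultrafilter.eventually_or]
    have hdis : Disjoint (E A) (E B) := by
      refine Set.disjoint_left.2 fun s hA hB => ?_
      obtain ⟨h, hhA, hhB⟩ := (hA.and hB).exists
      exact Set.disjoint_left.1 ((Set.disjoint_image_iff Subtype.val_injective).2 hAB) hhA hhB
    simp only [hunion, hm.2.2 _ _ hdis]
  · have : E A = ∅ := by
      refine Set.eq_empty_of_forall_notMem fun s hs => ?_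
      obtain ⟨k, -, hk⟩ := (Ultrafilter.eventually_exists_mem_iff (hA.image Subtype.val)
        (P := fun k h => c s h = k)).1 (hs.mono fun h hh => ⟨_, hh, rfl⟩)
      have hfix : ∀ z, z ≠ x →
          ((MulAction.toPerm s)⁻¹ * k * MulAction.toPerm s : Equiv.Perm X) z = z := by
        intro z hz
        obtain ⟨h, hh, hhk⟩ :=
          ((hsupp _ (compl_singleton_mem_nhds hz.symm)).and hk).exists
        rw [← hhk]
        simpa [c, mul_assoc] using hh z (by simp)
      obtain ⟨h, hh, hhk⟩ := (hne.and hk).exists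
      refine hh (Equiv.ext fun z => ?_)
      have hhfix : ∀ z, z ≠ x → h z = z := fun z hz => by
        have := hfix z hz
        rw [← hhk] at this
        simpa [c, mul_assoc] using this
      by_cases hz : z = x
      · by_contra hzx
        exact hzx (h.injective (hhfix (h z) fun h' => hzx (h'.trans hz.symm)))
      · exact hhfix z hz
    simp only [this, hm.apply_empty]
  · obtain ⟨n, A, t, hA, hAdis, hAuniv, ht⟩ := hG (G.inv_mem T.2)
    have key : ∀ i s, s • x ∈ A i →
        (s ∈ E ((fun h => T * h * T⁻¹) '' B) ↔ t i * s ∈ E B) := by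
      intro i s hs
      refine eventually_congr ?_
      filter_upwards [hsupp _ (((hA i).isOpen.preimage (hcont s)).mem_nhds hs)] with h hh
      have h1 := Equiv.Perm.conj_eq_conj_of_eqOn (a := (T : Equiv.Perm X)⁻¹ * MulAction.toPerm s)
        (b := MulAction.toPerm (t i * s)) (V := (fun x => s • x) ⁻¹' A i)
        (fun z hz => (ht i _ hz).trans (mul_smul _ _ _).symm) hh
      have h2 : c (t i * s) h = (T : Equiv.Perm X)⁻¹ * c s h * T := by
        refine h1.symm.trans ?_
        simp only [c]
        group
      rw [h2]
      constructor
      · rintro ⟨_, ⟨k, hk, rfl⟩, h'⟩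
        refine ⟨k, hk, ?_⟩
        rw [← h']
        simp [mul_assoc]
      · rintro ⟨k, hk, h'⟩
        refine ⟨_, ⟨k, hk, rfl⟩, ?_⟩
        simp [h', mul_assoc]
    let P : Fin n → Set Γ := fun i => {s | s • x ∈ A i}
    let Q : Fin n → Set Γ := fun i => (fun s => t i * s) '' P i
    have hQ : ∀ i s, s ∈ Q i ↔ (T : Equiv.Perm X) (s • x) ∈ A i := by
      intro i s
      constructor
      · rintro ⟨r, hr, rfl⟩
        have := ht i _ hr
        rw [← mul_smul] at this
        simpa [← this] using (show r • x ∈ A i from hr)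
      · intro hs
        refine ⟨(t i)⁻¹ * s, ?_, by simp⟩
        have := ht i _ hs
        rw [Equiv.Perm.inv_def, Equiv.symm_apply_apply] at this
        change ((t i)⁻¹ * s) • x ∈ A i
        rwa [mul_smul, this, inv_smul_smul]
    have hP : Pairwise (Function.onFun Disjoint P) := fun i j hij =>
      Set.disjoint_left.2 fun s hi hj => Set.disjoint_left.1 (hAdis hij) hi hj
    have hPuniv : ⋃ i, P i = Set.univ := Set.eq_univ_of_forall fun s => by
      simpa [P] using Set.mem_iUnion.1 (hAuniv.ge (Set.mem_univ (s • x)))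
    have hQdis : Pairwise (Function.onFun Disjoint Q) := fun i j hij =>
      Set.disjoint_left.2 fun s hi hj =>
        Set.disjoint_left.1 (hAdis hij) ((hQ i s).1 hi) ((hQ j s).1 hj)
    have hQuniv : ⋃ i, Q i = Set.univ := Set.eq_univ_of_forall fun s => by
      simpa [hQ] using Set.mem_iUnion.1 (hAuniv.ge (Set.mem_univ ((T : Equiv.Perm X) (s • x))))
    change m (E _) = m (E B)
    rw [hm.apply_eq_sum_inter hP hPuniv, hm.apply_eq_sum_inter hQdis hQuniv (E B)]
    refine Finset.sum_congr rfl fun i _ => ?_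
    rw [← hinv (t i)]
    congr 1
    ext s
    constructor
    · rintro ⟨r, ⟨hr, hrP⟩, rfl⟩
      exact ⟨(key i r hrP).1 hr, r, hrP, rfl⟩
    · rintro ⟨hs, r, hrP, rfl⟩
      exact ⟨r, ⟨(key i r hrP).2 hs, hrP⟩, rfl⟩

theorem innerAmenable_of_orbit_recurrent [T2Space X] [CompactSpace X]
    [TotallyDisconnectedSpace X] (hcont : ∀ g : Γ, Continuous fun x : X => g • x)
    (hamen : HasLeftInvariantMean Γ) (G : Subgroup (Equiv.Perm X))
    (hG : (G : Set (Equiv.Perm X)) ⊆ {T | IsPiecewiseTranslation Γ T})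
    (halt : dynAlternating Γ X ≤ G) (x : X)
    (hx : ∀ U : Set X, IsOpen U → x ∈ U → ∃ y, 2 < (MulAction.orbit Γ y ∩ U).encard) :
    InnerAmenable G := by
  let N : Set X → Set (Equiv.Perm X) := fun V => {h | h ≠ 1 ∧ (∀ z ∉ V, h z = z) ∧
    ∀ s : Γ, MulAction.toPerm s * h * (MulAction.toPerm s)⁻¹ ∈ G}
  have hN : Monotone N := fun V W hVW h hh => ⟨hh.1, fun z hz => hh.2.1 z fun hzV => hz (hVW hzV),
    hh.2.2⟩
  have : NeBot ((𝓝 x).lift' N) := by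
    refine (lift'_neBot_iff hN).2 fun V hV => ?_
    obtain ⟨U, hUV, hU, hxU⟩ := mem_nhds_iff.1 hV
    obtain ⟨y, hy⟩ := hx U hU hxU
    obtain ⟨S, hS, hS3⟩ := Set.exists_subset_encard_eq (k := 3) (Order.add_one_le_of_lt hy)
    have hSfin : S.Finite := Set.finite_of_encard_eq_coe (k := 3) hS3
    have hcard : S.ncard = 3 := by simp [Set.ncard, hS3]
    have := hSfin.to_subtype
    let f : S ≃ Fin 3 := Finite.equivFinOfCardEq hcard
    choose g hg using fun i => (hS (f.symm i).2).1
    obtain ⟨h, h1, hhU, hh⟩ := exists_conj_mem_dynAlternating hcont hU (g := g) (y := y)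
      (fun i j hij => f.symm.injective (Subtype.ext ((hg i).symm.trans (hij.trans (hg j)))))
      (fun i => Set.mem_of_eq_of_mem (hg i) (hS (f.symm i).2).2)
    exact ⟨h, hN hUV ⟨h1, hhU, fun s => halt (hh s)⟩⟩
  have hev : ∀ V ∈ 𝓝 x,
      ∀ᶠ h in (Ultrafilter.of ((𝓝 x).lift' N) : Filter (Equiv.Perm X)), h ∈ N V :=
    fun V hV => Ultrafilter.of_le _ (mem_lift' hV)
  exact innerAmenable_of_ultrafilter hcont hamen G hG x (Ultrafilter.of ((𝓝 x).lift' N))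
    ((hev _ univ_mem).mono fun h hh => hh.1) (fun V hV => (hev V hV).mono fun h hh => hh.2.1)
    ((hev _ univ_mem).mono fun h hh => hh.2.2)

end

/-- For an action of a countably infinite amenable group `Γ` on the Cantor set `X`, every
infinite subgroup `G` of the topological full group containing `𝔄(Γ, X)` is inner
amenable. -/
theorem stmt15 {Γ X : Type*} [Group Γ] [Countable Γ] [Infinite Γ] [TopologicalSpace X]
    [CompactSpace X] [TopologicalSpace.MetrizableSpace X] [TotallyDisconnectedSpace X]
    [Nonempty X] [MulAction Γ X]
    (hiso : ∀ x : X, ¬ IsOpen ({x} : Set X))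
    (hcont : ∀ g : Γ, Continuous fun x : X => g • x)
    (hamen : HasLeftInvariantMean Γ)
    (G : Subgroup (Equiv.Perm X))
    (hG : (G : Set (Equiv.Perm X)) ⊆ {T | IsPiecewiseTranslation Γ T})
    (halt : dynAlternating Γ X ≤ G)
    (hinf : Infinite G) :
    InnerAmenable G := by
  by_cases hx : ∃ x : X, ∀ U : Set X, IsOpen U → x ∈ U →
      ∃ y, 2 < (MulAction.orbit Γ y ∩ U).encard
  · obtain ⟨x, hx⟩ := hx
    exact innerAmenable_of_orbit_recurrent hcont hamen G hG halt x hx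
  · push Not at hx
    choose U hU hxU hle using hx
    obtain ⟨t, ht⟩ := CompactSpace.elim_nhds_subcover U fun x => (hU x).mem_nhds (hxU x)
    classical
    refine innerAmenable_of_orbit_encard_le G (2 * (t.image U).card) fun x =>
      (Set.encard_le_encard ?_).trans (encard_inter_biUnion_le (t.image U) (MulAction.orbit Γ x) ?_)
    · rintro _ ⟨g, rfl⟩
      refine ⟨?_, ?_⟩
      · obtain ⟨n, A, s, -, -, hA, hs⟩ := hG g.2
        obtain ⟨i, hi⟩ := Set.mem_iUnion.1 (hA.ge (Set.mem_univ x))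
        exact ⟨s i, (hs i x hi).symm⟩
      · rw [Finset.set_biUnion_finset_image]
        exact ht.ge trivial
    · intro V hV
      obtain ⟨z, -, rfl⟩ := Finset.mem_image.1 hV
      exact hle z x
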